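/- Let R be a ring and let D(R) denote the (unbounded) derived category of the abelian category of all R-modules. Call an object of D(R) perfect if it is isomorphic in D(R) to a bounded complex of finitely generated projective R-modules. Let M and N be perfect objects of D(R). Then the following are equivalent: (1) there exist a perfect object Z_l of D(R), a morphism u_l : Z_l → M and a nilpotent endomorphism v_l : Z_l → Z_l such that the morphism Z_l → Z_l ⊕ M with components v_l and u_l fits into a distinguished triangle Z_l → Z_l ⊕ M → N → Z_l[1] in D(R); (2) there exist a perfect object Z_r of D(R), a morphism u_r : M → Z_r and a nilpotent endomorphism v_r : Z_r → Z_r such that the morphism M ⊕ Z_r → Z_r with components u_r and v_r fits into a distinguished triangle N → M ⊕ Z_r → Z_r → N[1] in D(R). -/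

import Mathlib

open CategoryTheory CategoryTheory.Limits CategoryTheory.Pretriangulated

universe w u

variable (R : Type u) [Ring R] [HasDerivedCategory.{w} (ModuleCat.{u} R)]

/-- An object of the derived category `D(R)` of the category of `R`-modules is *perfect* if
it is isomorphic in `D(R)` to a bounded complex of finitely generated projective modules. -/
def IsPerfectComplex (X : DerivedCategory (ModuleCat.{u} R)) : Prop :=
  ∃ P : CochainComplex (ModuleCat.{u} R) ℤ,
    (∃ a b : ℤ, ∀ i : ℤ, (i < a ∨ b < i) → IsZero (P.X i)) ∧
    (∀ i : ℤ, Module.Finite R (P.X i) ∧ Module.Projective R (P.X i)) ∧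
    Nonempty (X ≅ DerivedCategory.Q.obj P)

section Triangulated

variable {C : Type*} [Category* C] [Preadditive C] [HasZeroObject C] [HasShift C ℤ]
  [∀ n : ℤ, (shiftFunctor C n).Additive] [Pretriangulated C]

lemma distinguished_of_isos {X Y Z X' Y' Z' : C} {f : X ⟶ Y} {g : Y ⟶ Z} {h : Z ⟶ X⟦(1 : ℤ)⟧}
    {f' : X' ⟶ Y'} {g' : Y' ⟶ Z'} {h' : Z' ⟶ X'⟦(1 : ℤ)⟧}
    (hT : Triangle.mk f g h ∈ distTriang C) (e₁ : X' ≅ X) (e₂ : Y' ≅ Y) (e₃ : Z' ≅ Z)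
    (h₁ : f' ≫ e₂.hom = e₁.hom ≫ f) (h₂ : g' ≫ e₃.hom = e₂.hom ≫ g)
    (h₃ : h' ≫ e₁.hom⟦1⟧' = e₃.hom ≫ h) : Triangle.mk f' g' h' ∈ distTriang C :=
  isomorphic_distinguished _ hT _ (Triangle.isoMk _ _ e₁ e₂ e₃ h₁ h₂ h₃)

lemma isIso_of_distinguished {X Y Z X' Y' Z' : C} {f : X ⟶ Y} {g : Y ⟶ Z}
    {h : Z ⟶ X⟦(1 : ℤ)⟧} {f' : X' ⟶ Y'} {g' : Y' ⟶ Z'} {h' : Z' ⟶ X'⟦(1 : ℤ)⟧}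
    (hT : Triangle.mk f g h ∈ distTriang C) (hT' : Triangle.mk f' g' h' ∈ distTriang C)
    (a₁ : X ⟶ X') (a₂ : Y ⟶ Y') (a₃ : Z ⟶ Z') [IsIso a₁] [IsIso a₃]
    (h₁ : f ≫ a₂ = a₁ ≫ f') (h₂ : g ≫ a₃ = a₂ ≫ g') (h₃ : h ≫ a₁⟦1⟧' = a₃ ≫ h') :
    IsIso a₂ :=
  isIso₂_of_isIso₁₃ (T := Triangle.mk f g h) (T' := Triangle.mk f' g' h')
    ⟨a₁, a₂, a₃, h₁, h₂, h₃⟩ hT hT' ‹_› ‹_›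

lemma rotate_mk_distinguished {X Y Z : C} {f : X ⟶ Y} {g : Y ⟶ Z} {h : Z ⟶ X⟦(1 : ℤ)⟧} :
    Triangle.mk f g h ∈ distTriang C ↔ Triangle.mk g h (-f⟦1⟧') ∈ distTriang C :=
  rotate_distinguished_triangle _

/-- In a distinguished triangle, the second object may be replaced along an isomorphism. -/
lemma distinguished_replace_obj₂ {X Y Y' Z : C} {f : X ⟶ Y} {g : Y ⟶ Z} {h : Z ⟶ X⟦(1 : ℤ)⟧}
    (hT : Triangle.mk f g h ∈ distTriang C) (e : Y ≅ Y') :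
    Triangle.mk (f ≫ e.hom) (e.inv ≫ g) h ∈ distTriang C :=
  distinguished_of_isos hT (Iso.refl _) e.symm (Iso.refl _) (by simp) (by simp) (by simp)

/-- A direct sum decomposition of `Y`, as a split distinguished triangle. -/
lemma split_triangle_distinguished {X Y Z : C} {i : X ⟶ Y} {p : Y ⟶ Z} (r : Y ⟶ X) (σ : Z ⟶ Y)
    (hir : i ≫ r = 𝟙 X) (hip : i ≫ p = 0) (hσr : σ ≫ r = 0) (hσp : σ ≫ p = 𝟙 Z)
    (htot : r ≫ i + p ≫ σ = 𝟙 Y) :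
    Triangle.mk i p (0 : Z ⟶ X⟦(1 : ℤ)⟧) ∈ distTriang C :=
  distinguished_of_isos (binaryBiproductTriangle_distinguished X Z) (Iso.refl _)
      { hom := biprod.lift r p
        inv := biprod.desc i σ
        hom_inv_id := by simpa [biprod.lift_desc] using htot
        inv_hom_id := by ext <;> simp [*] }
      (Iso.refl _)
      (by ext <;> simp [*]) (by simp) (by simp)

/-- Two distinguished triangles with the same second morphism have isomorphic first objects. -/
lemma nonempty_iso_obj₁ {X X' Y Z : C} {f : X ⟶ Y} {f' : X' ⟶ Y} {g : Y ⟶ Z}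
    {h : Z ⟶ X⟦(1 : ℤ)⟧} {h' : Z ⟶ X'⟦(1 : ℤ)⟧} (hT : Triangle.mk f g h ∈ distTriang C)
    (hT' : Triangle.mk f' g h' ∈ distTriang C) : Nonempty (X ≅ X') := by
  obtain ⟨a, h₁, h₂⟩ := complete_distinguished_triangle_morphism₁ _ _ hT hT' (𝟙 Y) (𝟙 Z)
    ((Category.comp_id g).trans (Category.id_comp g).symm)
  have : IsIso a := isIso₁_of_isIso₂₃ (Triangle.homMk _ _ a (𝟙 Y) (𝟙 Z) h₁
    ((Category.comp_id g).trans (Category.id_comp g).symm) h₂) hT hT'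
    (inferInstanceAs (IsIso (𝟙 Y))) (inferInstanceAs (IsIso (𝟙 Z)))
  exact ⟨@asIso _ _ _ _ a this⟩

/-- A cone isomorphic to `N⟦1⟧` exhibits `N` as a fiber. -/
lemma exists_fiber_triangle {X Y Z N : C} {f : X ⟶ Y} {g : Y ⟶ Z} {h : Z ⟶ X⟦(1 : ℤ)⟧}
    (hT : Triangle.mk f g h ∈ distTriang C) (e : Z ≅ N⟦(1 : ℤ)⟧) :
    ∃ (k : N ⟶ X) (h' : Y ⟶ N⟦(1 : ℤ)⟧), Triangle.mk k f h' ∈ distTriang C := by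
  obtain ⟨k, hk⟩ := (shiftFunctor C (1 : ℤ)).map_surjective (-(e.inv ≫ h))
  refine ⟨k, g ≫ e.hom, ?_⟩
  rw [rotate_mk_distinguished]
  exact distinguished_of_isos hT (Iso.refl _) (Iso.refl _) e.symm (by simp) (by simp)
    (by simp [hk])

/-- An endomorphism of the third object of a distinguished triangle is nilpotent if it is
compatible with nilpotent endomorphisms of the first two objects. -/
lemma isNilpotent_of_triangle {X Y Z : C} {f : X ⟶ Y} {g : Y ⟶ Z} {h : Z ⟶ X⟦(1 : ℤ)⟧}
    (hT : Triangle.mk f g h ∈ distTriang C) {x : End X} {y : End Y} {z : End Z}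
    (hx : IsNilpotent x) (hy : IsNilpotent y) (hyz : g ≫ (z : Z ⟶ Z) = (y : Y ⟶ Y) ≫ g)
    (hzx : (z : Z ⟶ Z) ≫ h = h ≫ (x : X ⟶ X)⟦1⟧') : IsNilpotent z := by
  have h₁ (n : ℕ) : g ≫ (z ^ n : End Z) = (y ^ n : End Y) ≫ g := by
    induction n with
    | zero => simp [End.one_def]
    | succ n ih =>
      rw [pow_succ, pow_succ, End.mul_def, End.mul_def, ← Category.assoc, hyz, Category.assoc, ih,
        Category.assoc]
  have h₂ (n : ℕ) : (z ^ n : End Z) ≫ h = h ≫ ((x ^ n : End X) : X ⟶ X)⟦1⟧' := by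
    induction n with
    | zero => simp [End.one_def]
    | succ n ih =>
      rw [pow_succ, pow_succ, End.mul_def, End.mul_def, Category.assoc, ih, ← Category.assoc, hzx,
        Functor.map_comp, Category.assoc]
  obtain ⟨m, hm⟩ := hx
  obtain ⟨n, hn⟩ := hy
  have hgz : g ≫ (z ^ n : End Z) = 0 := by
    rw [h₁, hn]
    exact zero_comp
  obtain ⟨k, hk⟩ : ∃ k : X⟦(1 : ℤ)⟧ ⟶ Z, (z ^ n : End Z) = h ≫ k :=
    Triangle.yoneda_exact₃ _ hT (z ^ n : End Z) hgz
  have hzh : (z ^ m : End Z) ≫ h = 0 := by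
    rw [h₂, hm]
    exact (congrArg (h ≫ ·) ((shiftFunctor C (1 : ℤ)).map_zero X X)).trans comp_zero
  refine ⟨n + m, ?_⟩
  rw [pow_add, End.mul_def, hk, ← Category.assoc, hzh]
  exact zero_comp

/-- Attaching a split summand to the target of a morphism adds it to the cone. -/
lemma exists_iso_cone_comp_inr [IsTriangulated C] (M : C) {Z A W X : C} {s : Z ⟶ A} {q : A ⟶ W}
    {p : W ⟶ Z⟦(1 : ℤ)⟧} (hW : Triangle.mk s q p ∈ distTriang C)
    {c : M ⊞ A ⟶ X} {d : X ⟶ Z⟦(1 : ℤ)⟧}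
    (hX : Triangle.mk (s ≫ (biprod.inr : A ⟶ M ⊞ A)) c d ∈ distTriang C) :
    ∃ e : M ⊞ W ≅ X, biprod.inl ≫ e.hom = biprod.inl ≫ c ∧
      q ≫ biprod.inr ≫ e.hom = biprod.inr ≫ c ∧ biprod.inr ≫ e.hom ≫ d = p := by
  have hM (B : C) :
      Triangle.mk (biprod.inr : B ⟶ M ⊞ B) (biprod.fst : M ⊞ B ⟶ M) 0 ∈ distTriang C :=
    split_triangle_distinguished biprod.snd biprod.inl (by simp) (by simp) (by simp) (by simp)
      (by rw [add_comm]; exact biprod.total)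
  let o := Triangulated.someOctahedron rfl hW (hM A) hX
  have ho : o.m₁ ≫ o.m₃ = 0 := comp_distTriang_mor_zero₁₂ _ o.mem
  have : IsIso (biprod.desc (biprod.inl ≫ c) o.m₁) :=
    isIso_of_distinguished (hM W) o.mem (𝟙 W) _ (𝟙 M) (by simp)
      (by ext <;> simp [o.comm₃, ho]) (by simp)
  exact ⟨asIso (biprod.desc (biprod.inl ≫ c) o.m₁), by simp, by simp [o.comm₁], by simp [o.comm₂]⟩

/-- The cone of `s` carries an endomorphism induced by `v` and `t`, for which the fiber of the
resulting morphism `M ⊞ W ⟶ W` is the cone of `Z ⟶ Z ⊞ M`. -/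
lemma exists_endomorphism_of_cone [IsTriangulated C] {M Z N A W : C}
    {v : Z ⟶ Z} {u : Z ⟶ M} {g : Z ⊞ M ⟶ N} {h : N ⟶ Z⟦(1 : ℤ)⟧}
    (hN : Triangle.mk (biprod.lift v u) g h ∈ distTriang C)
    {s : Z ⟶ A} {q : A ⟶ W} {p : W ⟶ Z⟦(1 : ℤ)⟧} (hW : Triangle.mk s q p ∈ distTriang C)
    {i : M ⟶ A} {t : A ⟶ A} {e : A ⟶ M} {j : M ⟶ A} (hst : v ≫ s = s ≫ t) (hse : s ≫ e = u)
    (hje : j ≫ e = 𝟙 M)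
    (hA : Triangle.mk (j ≫ biprod.inr : M ⟶ M ⊞ A) (biprod.desc i t) 0 ∈ distTriang C) :
    ∃ (T : W ⟶ W) (f : N ⟶ M ⊞ W) (h' : W ⟶ N⟦(1 : ℤ)⟧), q ≫ T = t ≫ q ∧
      T ≫ p = p ≫ v⟦1⟧' ∧ Triangle.mk f (biprod.desc (i ≫ q) T) h' ∈ distTriang C := by
  obtain ⟨V, ι, δ, hV⟩ := distinguished_cocone_triangle v
  obtain ⟨X, c, d, hX⟩ := distinguished_cocone_triangle (s ≫ (biprod.inr : A ⟶ M ⊞ A))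
  obtain ⟨Y, r, δY, hY⟩ := distinguished_cocone_triangle (v ≫ s)
  obtain ⟨ε, hε₁, hε₂, hε₃⟩ := exists_iso_cone_comp_inr M hW hX
  obtain ⟨⟨α, μ, hα₁, hα₂, hα₃, hμ, hαμ⟩⟩ := IsTriangulated.octahedron_axiom
    (u₁₃ := v ≫ s) (by simp [hst]) hX (rotate_mk_distinguished.1 hA) hY
  obtain ⟨⟨β, γ, hβ₁, hβ₂, hγ₁, hγ₂, hβγ⟩⟩ := IsTriangulated.octahedron_axiom rfl hV hW hY
  have hM : Triangle.mk (biprod.inr : M ⟶ Z ⊞ M) (biprod.fst : Z ⊞ M ⟶ Z) 0 ∈ distTriang C :=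
    split_triangle_distinguished biprod.snd biprod.inl (by simp) (by simp) (by simp) (by simp)
      (by rw [add_comm]; exact biprod.total)
  obtain ⟨⟨n, ν, -, -, -, hν, hnν⟩⟩ := IsTriangulated.octahedron_axiom (u₁₃ := v) (by simp) hN
    (rotate_mk_distinguished.1 hM) hV
  obtain ⟨D, r', δD, hD⟩ := distinguished_cocone_triangle (α ≫ γ)
  obtain ⟨⟨a, b, -, -, -, -, hab⟩⟩ := IsTriangulated.octahedron_axiom rfl
    hαμ (rotate_mk_distinguished.1 hβγ) hD
  have hμ' : μ = -(δY ≫ u⟦1⟧') := by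
    have := hμ =≫ (biprod.snd ≫ e)⟦1⟧'
    simp only [Category.assoc, Preadditive.neg_comp, Preadditive.comp_neg,
      ← Functor.map_comp, biprod.inr_snd_assoc, hse, hje] at this
    simp [this]
  have hν' : ν = -(δ ≫ u⟦1⟧') := by
    have := hν =≫ (biprod.snd)⟦1⟧'
    simp only [Category.assoc, Preadditive.neg_comp, Preadditive.comp_neg,
      ← Functor.map_comp, biprod.inr_snd, biprod.lift_snd] at this
    simp [this]
  have hβμ : β ≫ μ = ν := by
    simp [hμ', hν', ← hβ₂]
  have hN' := rotate_mk_distinguished.1 (rotate_mk_distinguished.1 (rotate_mk_distinguished.1 hnν))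
  have hab' := rotate_mk_distinguished.1 hab
  rw [show (-β⟦(1 : ℤ)⟧') ≫ μ⟦(1 : ℤ)⟧' = -ν⟦(1 : ℤ)⟧' by
    rw [Preadditive.neg_comp, ← Functor.map_comp, hβμ]] at hab'
  obtain ⟨iso⟩ := nonempty_iso_obj₁ hab' hN'
  obtain ⟨k, h', hk⟩ := exists_fiber_triangle hD iso
  refine ⟨biprod.inr ≫ ε.hom ≫ α ≫ γ, k ≫ ε.inv, h', ?_, ?_, ?_⟩
  · rw [reassoc_of% hε₂, reassoc_of% hα₁, hγ₁]
    simp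
  · simp only [Category.assoc]
    rw [← hγ₂, reassoc_of% hα₂, reassoc_of% hε₃]
  · have hT : biprod.desc (i ≫ q) (biprod.inr ≫ ε.hom ≫ α ≫ γ) = ε.hom ≫ α ≫ γ := by
      apply biprod.hom_ext'
      · rw [biprod.inl_desc, reassoc_of% hε₁, reassoc_of% hα₁, hγ₁, biprod.inl_desc_assoc]
      · rw [biprod.inr_desc]
    rw [hT]
    exact distinguished_replace_obj₂ hk ε.symm

lemma prop_biprod (P : ObjectProperty C) [P.IsTriangulated]
    [P.IsClosedUnderIsomorphisms] {X Y : C} (hX : P X) (hY : P Y) : P (X ⊞ Y) :=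
  P.ext_of_isTriangulatedClosed₂ _ (binaryBiproductTriangle_distinguished X Y) hX hY

/-- The object `A` is a sum of `k + 1` copies of `M`, on which `t` is the shift of the components,
and the components of `s` are the composites `v ^ r ≫ u`. -/
lemma exists_truncation (P : ObjectProperty C) [P.IsTriangulated] [P.IsClosedUnderIsomorphisms]
    {M Z : C} (hM : P M) (v : End Z) (u : Z ⟶ M) (k : ℕ) :
    ∃ (A : C) (i : M ⟶ A) (t : End A) (e f : A ⟶ M) (g : A ⟶ A) (j : M ⟶ A) (s : Z ⟶ A),
      P A ∧ IsNilpotent t ∧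
      s ≫ (t : A ⟶ A) = (v : Z ⟶ Z) ≫ s - (v ^ (k + 1) : End Z) ≫ u ≫ i ∧ s ≫ e = u ∧
      i ≫ f = 𝟙 M ∧ (t : A ⟶ A) ≫ f = 0 ∧ i ≫ g = 0 ∧ (t : A ⟶ A) ≫ g + e ≫ j = 𝟙 A ∧
      g ≫ e = 0 ∧ j ≫ e = 𝟙 M ∧ f ≫ i + g ≫ (t : A ⟶ A) = 𝟙 A ∧ j ≫ (t : A ⟶ A) = 0 := by
  induction k with
  | zero =>
    exact ⟨M, 𝟙 M, 0, 𝟙 M, 𝟙 M, 0, 𝟙 M, u, hM, IsNilpotent.zero, by simp, by simp, by simp,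
      zero_comp, by simp, by simp, by simp, by simp, by simp, comp_zero⟩
  | succ k ih =>
    obtain ⟨A, i, t, e, f, g, j, s, hA, ⟨n, hn⟩, hst, hse, hif, htf, hig, htg, hge, hje, hfg,
      hjt⟩ := ih
    let τ : End (A ⊞ M) := biprod.lift (biprod.fst ≫ (t : A ⟶ A)) (biprod.fst ≫ e)
    have hτ₁ (m : ℕ) : (τ ^ m : End (A ⊞ M)) ≫ biprod.fst = biprod.fst ≫ (t ^ m : End A) := by
      induction m with
      | zero => simp [End.one_def]
      | succ m ih =>
        rw [pow_succ, pow_succ, End.mul_def, End.mul_def, Category.assoc, ih]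
        simp [τ]
    have hτ₂ : τ = (biprod.fst : A ⊞ M ⟶ A) ≫ biprod.lift (t : A ⟶ A) e := by
      apply biprod.hom_ext <;> simp [τ]
    refine ⟨A ⊞ M, i ≫ biprod.inl, τ, biprod.snd, biprod.fst ≫ f, biprod.desc g j ≫ biprod.inl,
      biprod.inr, biprod.lift ((v : Z ⟶ Z) ≫ s) u, prop_biprod P hA hM, ⟨n + 1, ?_⟩, ?_, ?_, ?_, ?_,
      ?_, ?_, ?_, ?_, ?_, ?_⟩
    · rw [pow_succ', End.mul_def]
      have h₀ : (biprod.fst : A ⊞ M ⟶ A) ≫ (t ^ n : End A) ≫ biprod.lift (t : A ⟶ A) e = 0 := by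
        rw [hn]
        exact (congrArg _ zero_comp).trans comp_zero
      refine (congrArg ((τ ^ n : End (A ⊞ M)) ≫ ·) hτ₂).trans ?_
      rw [reassoc_of% hτ₁ n, h₀]
    · rw [pow_succ, End.mul_def]
      apply biprod.hom_ext <;> simp [τ, hst, hse]
    · simp
    · simp [hif]
    · simp [τ, htf]
    · simp [reassoc_of% hig]
    · apply biprod.hom_ext' <;> apply biprod.hom_ext <;> simp [τ, htg]
    · simp
    · simp
    · apply biprod.hom_ext' <;> apply biprod.hom_ext <;> simp [τ, hfg, hge, hje, hjt]
    · apply biprod.hom_ext <;> simp [τ]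

/-- In a triangulated category `C` with a triangulated subcategory `P`, left nilpotent
degeneration implies right nilpotent degeneration. -/
lemma right_degeneration_of_left_degeneration [IsTriangulated C] (P : ObjectProperty C)
    [P.IsTriangulated] [P.IsClosedUnderIsomorphisms] {M N Z : C} (hM : P M) (hZ : P Z)
    {u : Z ⟶ M} {v : End Z} {g : Z ⊞ M ⟶ N} {h : N ⟶ Z⟦(1 : ℤ)⟧} (hv : IsNilpotent v)
    (hT : Triangle.mk (biprod.lift (v : Z ⟶ Z) u) g h ∈ distTriang C) :
    ∃ (W : C) (u' : M ⟶ W) (v' : End W) (f : N ⟶ M ⊞ W) (h' : W ⟶ N⟦(1 : ℤ)⟧),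
      P W ∧ IsNilpotent v' ∧
      Triangle.mk f (biprod.desc u' (v' : W ⟶ W)) h' ∈ distTriang C := by
  obtain ⟨n, hn⟩ := hv
  obtain ⟨A, i, t, e, f, g', j, s, hA, ht, hst, hse, hif, htf, hig, htg, hge, hje, hfg, hjt⟩ :=
    exists_truncation P hM v u n
  have h₀ : (v ^ (n + 1) : End Z) ≫ u ≫ i = 0 := by
    rw [pow_succ', hn, mul_zero]
    exact zero_comp
  rw [h₀, sub_zero] at hst
  have hA' : Triangle.mk (j ≫ biprod.inr : M ⟶ M ⊞ A) (biprod.desc i (t : A ⟶ A)) 0 ∈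
      distTriang C :=
    split_triangle_distinguished (biprod.snd ≫ e) (biprod.lift f g') (by simp [hje])
      (by simp [hjt]) (by simp [hge]) (by simp [hfg])
      (by
        rw [add_comm] at htg
        apply biprod.hom_ext' <;> apply biprod.hom_ext <;> simp [hif, hig, htf, htg])
  obtain ⟨W, q, p, hp, hW⟩ : ∃ (W : C) (q : A ⟶ W) (p : W ⟶ Z⟦(1 : ℤ)⟧), P W ∧
      Triangle.mk s q p ∈ distTriang C := by
    obtain ⟨W, q, p, hW⟩ := distinguished_cocone_triangle s
    exact ⟨W, q, p, P.ext_of_isTriangulatedClosed₃ _ hW hZ hA, hW⟩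
  obtain ⟨T, k, h', hqT, hTp, hk⟩ := exists_endomorphism_of_cone hT hW hst.symm hse hje hA'
  exact ⟨W, i ≫ q, T, k, h', hp, isNilpotent_of_triangle hW ⟨n, hn⟩ ht hqT hTp, hk⟩

section Opposite

open Pretriangulated.Opposite Opposite

lemma isNilpotent_op {D : Type*} [Category* D] [Preadditive D] {X : D} {v : End X}
    (hv : IsNilpotent v) :
    IsNilpotent (show End (op X) from Quiver.Hom.op (v : X ⟶ X)) := by
  obtain ⟨n, hn⟩ := hv
  let w : End (op X) := Quiver.Hom.op (v : X ⟶ X)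
  have h (m : ℕ) : (w ^ m : End (op X)) =
      Quiver.Hom.op (show X ⟶ X from (v ^ m : End X)) := by
    induction m with
    | zero => rfl
    | succ m ih => rw [pow_succ, pow_succ', ih]; rfl
  exact ⟨n, (h n).trans (by rw [hn]; rfl)⟩

lemma isNilpotent_unop {D : Type*} [Category* D] [Preadditive D] {X : Dᵒᵖ} {v : End X}
    (hv : IsNilpotent v) :
    IsNilpotent (show End X.unop from Quiver.Hom.unop (v : X ⟶ X)) := by
  obtain ⟨n, hn⟩ := hv
  let w : End X.unop := Quiver.Hom.unop (v : X ⟶ X)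
  have h (m : ℕ) : (w ^ m : End X.unop) =
      Quiver.Hom.unop (show X ⟶ X from (v ^ m : End X)) := by
    induction m with
    | zero => rfl
    | succ m ih => rw [pow_succ, pow_succ', ih]; rfl
  exact ⟨n, (h n).trans (by rw [hn]; rfl)⟩

lemma exists_op_distinguished {X Y Z : C} {f : X ⟶ Y} {g : Y ⟶ Z} {h : Z ⟶ X⟦(1 : ℤ)⟧}
    (hT : Triangle.mk f g h ∈ distTriang C) :
    ∃ h' : op X ⟶ (op Z)⟦(1 : ℤ)⟧, Triangle.mk g.op f.op h' ∈ distTriang Cᵒᵖ :=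
  ⟨_, op_distinguished _ hT⟩

lemma exists_unop_distinguished {X Y Z : Cᵒᵖ} {f : X ⟶ Y} {g : Y ⟶ Z} {h : Z ⟶ X⟦(1 : ℤ)⟧}
    (hT : Triangle.mk f g h ∈ distTriang Cᵒᵖ) :
    ∃ h' : X.unop ⟶ Z.unop⟦(1 : ℤ)⟧, Triangle.mk g.unop f.unop h' ∈ distTriang C :=
  ⟨_, unop_distinguished _ hT⟩

/-- In a triangulated category `C` with a triangulated subcategory `P`, right nilpotent
degeneration implies left nilpotent degeneration. -/
lemma left_degeneration_of_right_degeneration [IsTriangulated C] (P : ObjectProperty C)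
    [P.IsTriangulated] [P.IsClosedUnderIsomorphisms] {M N Z : C} (hM : P M) (hZ : P Z)
    {u : M ⟶ Z} {v : End Z} {f : N ⟶ M ⊞ Z} {h : Z ⟶ N⟦(1 : ℤ)⟧} (hv : IsNilpotent v)
    (hT : Triangle.mk f (biprod.desc u (v : Z ⟶ Z)) h ∈ distTriang C) :
    ∃ (W : C) (u' : W ⟶ M) (v' : End W) (g : W ⊞ M ⟶ N) (h' : N ⟶ W⟦(1 : ℤ)⟧),
      P W ∧ IsNilpotent v' ∧
      Triangle.mk (biprod.lift (v' : W ⟶ W) u') g h' ∈ distTriang C := by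
  obtain ⟨h₁, hT₁⟩ := exists_op_distinguished hT
  let e : op (M ⊞ Z) ≅ op Z ⊞ op M :=
    { hom := biprod.lift biprod.inr.op biprod.inl.op
      inv := biprod.desc biprod.snd.op biprod.fst.op
      hom_inv_id := by
        rw [biprod.lift_desc, ← op_comp, ← op_comp, ← op_add, add_comm, biprod.total, op_id]
      inv_hom_id := by
        apply biprod.hom_ext' <;> apply biprod.hom_ext <;> simp [← op_comp] }
  have hT₂ := distinguished_replace_obj₂ hT₁ e
  have he : (biprod.desc u (v : Z ⟶ Z)).op ≫ e.hom =
      biprod.lift (Quiver.Hom.op (v : Z ⟶ Z)) u.op := by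
    apply biprod.hom_ext <;> simp [e, ← op_comp]
  rw [he] at hT₂
  obtain ⟨W, u', v', k, h', hW, hv', hk⟩ :=
    right_degeneration_of_left_degeneration P.op (M := op M) (Z := op Z) hM hZ
      (isNilpotent_op hv) hT₂
  obtain ⟨h₃, hT₃⟩ := exists_unop_distinguished hk
  let e' : (op M ⊞ W).unop ≅ W.unop ⊞ M :=
    { hom := biprod.lift biprod.inr.unop biprod.inl.unop
      inv := biprod.desc biprod.snd.unop biprod.fst.unop
      hom_inv_id := by
        rw [biprod.lift_desc, ← unop_comp, ← unop_comp, ← unop_add, add_comm, biprod.total, unop_id]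
      inv_hom_id := by
        apply biprod.hom_ext' <;> apply biprod.hom_ext <;> simp [← unop_comp] }
  have hT₄ := distinguished_replace_obj₂ hT₃ e'
  have he' : (biprod.desc u' (v' : W ⟶ W)).unop ≫ e'.hom =
      biprod.lift (Quiver.Hom.unop (v' : W ⟶ W)) u'.unop := by
    apply biprod.hom_ext <;> simp [e', ← unop_comp]
  rw [he'] at hT₄
  exact ⟨W.unop, u'.unop, Quiver.Hom.unop (v' : W ⟶ W), _, h₃, hW, isNilpotent_unop hv', hT₄⟩

end Opposite

end Triangulated

section Perfect

open ZeroObject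

lemma exists_Q_map_eq {A : Type*} [Category* A] [Abelian A] [HasDerivedCategory A]
    {K L : CochainComplex A ℤ} [K.IsKProjective]
    (f : DerivedCategory.Q.obj K ⟶ DerivedCategory.Q.obj L) :
    ∃ φ : K ⟶ L, DerivedCategory.Q.map φ = f := by
  obtain ⟨ψ, hψ⟩ := (CochainComplex.IsKProjective.Qh_map_bijective K
    ((HomotopyCategory.quotient _ _).obj L)).surjective
      ((DerivedCategory.quotientCompQhIso A).hom.app K ≫ f ≫
        (DerivedCategory.quotientCompQhIso A).inv.app L)
  obtain ⟨φ, rfl⟩ := (HomotopyCategory.quotient _ _).map_surjective ψ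
  refine ⟨φ, ?_⟩
  have h := (DerivedCategory.quotientCompQhIso A).hom.naturality φ
  rw [← cancel_epi ((DerivedCategory.quotientCompQhIso A).hom.app K), ← h]
  exact (hψ =≫ _).trans (by simp)

lemma module_finite_projective_of_iso {S : Type u} [Ring S] {X Y : ModuleCat.{u} S} (e : X ≅ Y)
    (h : Module.Finite S X ∧ Module.Projective S X) :
    Module.Finite S Y ∧ Module.Projective S Y :=
  have := h.1
  have := h.2
  ⟨Module.Finite.equiv e.toLinearEquiv, Module.Projective.of_equiv e.toLinearEquiv⟩

lemma module_finite_projective_biprod {S : Type u} [Ring S] {X Y : ModuleCat.{u} S}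
    (hX : Module.Finite S X ∧ Module.Projective S X)
    (hY : Module.Finite S Y ∧ Module.Projective S Y) :
    Module.Finite S (X ⊞ Y : ModuleCat.{u} S) ∧ Module.Projective S (X ⊞ Y : ModuleCat.{u} S) := by
  have := hX.1
  have := hX.2
  have := hY.1
  have := hY.2
  exact module_finite_projective_of_iso (ModuleCat.biprodIsoProd X Y).symm
    ⟨inferInstanceAs (Module.Finite S (X × Y)), inferInstanceAs (Module.Projective S (X × Y))⟩

lemma isKProjective_of_bounded {S : Type u} [Ring S] {P : CochainComplex (ModuleCat.{u} S) ℤ}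
    {b : ℤ} (hb : ∀ i, b < i → IsZero (P.X i)) (hP : ∀ i, Module.Projective S (P.X i)) :
    P.IsKProjective := by
  have : P.IsStrictlyLE b := by
    rw [CochainComplex.isStrictlyLE_iff]
    exact hb
  have (n : ℤ) : Projective (P.X n) := (IsProjective.iff_projective _).1 (hP n)
  exact CochainComplex.isKProjective_of_projective P b

/-- Perfect objects, as a property of objects. -/
abbrev perfectComplexes : ObjectProperty (DerivedCategory (ModuleCat.{u} R)) :=
  IsPerfectComplex R

variable {R}

instance : (perfectComplexes R).IsClosedUnderIsomorphisms where
  of_iso := by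
    rintro X Y e ⟨P, hP, hP', ⟨e'⟩⟩
    exact ⟨P, hP, hP', ⟨e.symm ≪≫ e'⟩⟩

instance : (perfectComplexes R).ContainsZero where
  exists_zero := by
    refine ⟨0, isZero_zero _, 0, ⟨0, 0, fun i _ => ?_⟩, fun i => ?_, ⟨?_⟩⟩
    · exact (HomologicalComplex.eval _ _ i).map_isZero (isZero_zero _)
    · have : Subsingleton ((0 : CochainComplex (ModuleCat.{u} R) ℤ).X i) :=
        ModuleCat.subsingleton_of_isZero
          ((HomologicalComplex.eval _ _ i).map_isZero (isZero_zero _))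
      exact ⟨inferInstance, inferInstance⟩
    · exact (isZero_zero _).iso (DerivedCategory.Q.map_isZero (isZero_zero _))

instance : (perfectComplexes R).IsStableUnderShift ℤ where
  isStableUnderShiftBy n :=
    { le_shift := by
        rintro X ⟨P, ⟨a, b, hab⟩, hP, ⟨e⟩⟩
        refine ⟨P⟦n⟧, ⟨a - n, b - n, fun i hi => ?_⟩, fun i => hP (i + n),
          ⟨(shiftFunctor _ n).mapIso e ≪≫ (DerivedCategory.Q.commShiftIso n).symm.app P⟩⟩
        exact hab (i + n) (by lia) }

instance : (perfectComplexes R).IsTriangulated where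
  toIsTriangulatedClosed₂ := by
    have : (perfectComplexes R).IsTriangulatedClosed₃ := by
      refine ObjectProperty.IsTriangulatedClosed₃.mk' fun T hT hT₁ hT₂ => ?_
      obtain ⟨P, ⟨a, b, hab⟩, hP, ⟨e₁⟩⟩ := hT₁
      obtain ⟨Q, ⟨c, d, hcd⟩, hQ, ⟨e₂⟩⟩ := hT₂
      have : P.IsKProjective := isKProjective_of_bounded (fun i hi => hab i (Or.inr hi))
        fun i => (hP i).2
      obtain ⟨φ, hφ⟩ := exists_Q_map_eq (e₁.inv ≫ T.mor₁ ≫ e₂.hom)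
      refine ⟨CochainComplex.mappingCone φ, ⟨min (a - 1) c, max b d, fun i hi => ?_⟩, fun i => ?_,
        ⟨?_⟩⟩
      · rw [CochainComplex.mappingCone.isZero_X_iff]
        exact ⟨hab _ (by lia), hcd _ (by lia)⟩
      · exact module_finite_projective_of_iso
          (HomologicalComplex.homotopyCofiber.XIsoBiprod φ i (i + 1) rfl).symm
          (module_finite_projective_biprod (hP (i + 1)) (hQ i))
      · exact Triangle.π₃.mapIso (isoTriangleOfIso₁₂ _ _ hT
          (DerivedCategory.mappingCone_triangle_distinguished φ) e₁ e₂ (by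
            change _ = _ ≫ DerivedCategory.Q.map φ
            rw [hφ, e₁.hom_inv_id_assoc]
            rfl))
    exact .of_isTriangulatedClosed₃

end Perfect

/-- **Theorem (main theorem, case (b), for `D(R)`).** For perfect objects `M`, `N` of the
derived category of a ring `R`, left nilpotent triangle degeneration is equivalent to right
nilpotent triangle degeneration. -/
theorem perfect_left_degeneration_iff_right_degeneration
    (M N : DerivedCategory (ModuleCat.{u} R))
    (hM : IsPerfectComplex R M) (hN : IsPerfectComplex R N) :
    (∃ (Zl : DerivedCategory (ModuleCat.{u} R)) (ul : Zl ⟶ M) (vl : End Zl)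
        (g : Zl ⊞ M ⟶ N) (h : N ⟶ Zl⟦(1 : ℤ)⟧),
        IsPerfectComplex R Zl ∧ IsNilpotent vl ∧
        Triangle.mk (biprod.lift (vl : Zl ⟶ Zl) ul) g h ∈
          (distTriang (DerivedCategory (ModuleCat.{u} R)))) ↔
    (∃ (Zr : DerivedCategory (ModuleCat.{u} R)) (ur : M ⟶ Zr) (vr : End Zr)
        (f : N ⟶ M ⊞ Zr) (h : Zr ⟶ N⟦(1 : ℤ)⟧),
        IsPerfectComplex R Zr ∧ IsNilpotent vr ∧
        Triangle.mk f (biprod.desc ur (vr : Zr ⟶ Zr)) h ∈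
          (distTriang (DerivedCategory (ModuleCat.{u} R)))) := by
  constructor
  · rintro ⟨Z, u, v, g, h, hZ, hv, hT⟩
    exact right_degeneration_of_left_degeneration (perfectComplexes R) hM hZ hv hT
  · rintro ⟨Z, u, v, f, h, hZ, hv, hT⟩
    exact left_degeneration_of_right_degeneration (perfectComplexes R) hM hZ hv hT
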